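/- arXiv:1708.07680 — 4 statements merged into one kernel-verified Lean document; each statement's English description precedes it below -/
import Mathlib

section
/- For every Inc(ℕ)-invariant ideal chain J∘ in R, the set I(J∘) of stability indices of initial ideal chains of J∘ with respect to Inc(ℕ)-compatible term orders is bounded above (and hence finite). -/
open MvPolynomial

/-- The ambient polynomial ring `R = K[x_{i,j} | i ∈ [c], j ∈ ℕ]`
(second variable indices are written `0`-based). -/
abbrev PolyR (K : Type*) [Field K] (c : ℕ) : Type _ := MvPolynomial (Fin c × ℕ) K

/-- The action of `p : ℕ → ℕ` on variable indices: `x_{i,j} ↦ x_{i,p(j)}`. -/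
def incVar (c : ℕ) (p : ℕ → ℕ) : Fin c × ℕ → Fin c × ℕ := fun v => (v.1, p v.2)

/-- The `K`-linear (in fact `K`-algebra) action of `p : ℕ → ℕ` on `R`. -/
noncomputable def incAct (K : Type*) [Field K] (c : ℕ) (p : ℕ → ℕ) :
    PolyR K c →ₐ[K] PolyR K c := rename (incVar c p)

/-- `Inc(ℕ)_{m,n}`: strictly increasing maps sending the first `m` variable indices
into the first `n` variable indices. -/
def IncIn (m n : ℕ) : Set (ℕ → ℕ) := {p | StrictMono p ∧ ∀ j < m, p j < n}

/-- `R_A`: the polynomials using only variables `x_{i,j}` with `j ∈ A`. -/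
def RsetOn (K : Type*) [Field K] (c : ℕ) (A : Set ℕ) : Set (PolyR K c) :=
  (supported K {v : Fin c × ℕ | v.2 ∈ A} : Subalgebra K (PolyR K c))

/-- `R_n`: the polynomials using only the first `n` variable indices. -/
def Rset (K : Type*) [Field K] (c n : ℕ) : Set (PolyR K c) := RsetOn K c {j | j < n}

/-- `J` is an ideal of the subring of `R` with underlying set `A`. -/
def IsIdealOf {K : Type*} [Field K] {c : ℕ} (J A : Set (PolyR K c)) : Prop :=
  J ⊆ A ∧ (0 : PolyR K c) ∈ J ∧ (∀ f ∈ J, ∀ g ∈ J, f + g ∈ J) ∧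
    ∀ a ∈ A, ∀ f ∈ J, a * f ∈ J

/-- The ideal of the subring of `R` with underlying set `A` generated by `S`. -/
def spanIn {K : Type*} [Field K] {c : ℕ} (A S : Set (PolyR K c)) : Set (PolyR K c) :=
  ⋂₀ {J : Set (PolyR K c) | IsIdealOf J A ∧ S ⊆ J}

/-- The set `Inc(ℕ)_{m,n} · S`. -/
def incOrbit (K : Type*) [Field K] (c m n : ℕ) (S : Set (PolyR K c)) : Set (PolyR K c) :=
  {g | ∃ p ∈ IncIn m n, ∃ f ∈ S, g = incAct K c p f}

/-- An `Inc(ℕ)`-invariant ideal chain in `R`. -/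
def IsIncChain (K : Type*) [Field K] (c : ℕ) (J : ℕ → Set (PolyR K c)) : Prop :=
  (∀ n, IsIdealOf (J n) (Rset K c n)) ∧
    ∀ m n, m ≤ n → incOrbit K c m n (J m) ⊆ J n

/-- The set of indices from which on the chain `J` is generated by `Inc(ℕ)`-shifts. -/
def stabSet (K : Type*) [Field K] (c : ℕ) (J : ℕ → Set (PolyR K c)) : Set ℕ :=
  {N | ∀ n, N ≤ n → spanIn (Rset K c n) (incOrbit K c N n (J N)) = J n}

/-- The stability index `Ind(J∘)` of an ideal chain. -/
noncomputable def Ind (K : Type*) [Field K] (c : ℕ) (J : ℕ → Set (PolyR K c)) : ℕ :=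
  sInf (stabSet K c J)

/-- A term order: a total order on monomials (identified with their exponent vectors,
so that multiplication of monomials becomes addition) which respects multiplication and
has the monomial `1` (exponent vector `0`) as least element. -/
structure TermOrder (σ : Type*) where
  le : (σ →₀ ℕ) → (σ →₀ ℕ) → Prop
  refl : ∀ a, le a a
  trans : ∀ a b c, le a b → le b c → le a c
  antisymm : ∀ a b, le a b → le b a → a = b
  total : ∀ a b, le a b ∨ le b a
  add_right : ∀ a b h, le a b → le (a + h) (b + h)
  zero_le : ∀ a, le 0 a

/-- A term order on `R` is `Inc(ℕ)`-compatible if it is preserved by the action of every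
strictly increasing map. -/
def IncCompatible (c : ℕ) (T : TermOrder (Fin c × ℕ)) : Prop :=
  ∀ p : ℕ → ℕ, StrictMono p → ∀ a b, T.le a b →
    T.le (Finsupp.mapDomain (incVar c p) a) (Finsupp.mapDomain (incVar c p) b)

/-- `a` is the exponent vector of the leading monomial of `f` with respect to `T`. -/
def IsLeadMon {K : Type*} [Field K] {c : ℕ} (T : TermOrder (Fin c × ℕ))
    (f : PolyR K c) (a : (Fin c × ℕ) →₀ ℕ) : Prop :=
  a ∈ f.support ∧ ∀ b ∈ f.support, T.le b a

/-- The set of leading monomials of the nonzero elements of `J`. -/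
def leadMonSet (K : Type*) [Field K] (c : ℕ) (T : TermOrder (Fin c × ℕ))
    (J : Set (PolyR K c)) : Set (PolyR K c) :=
  {g | ∃ f ∈ J, f ≠ 0 ∧ ∃ a, IsLeadMon T f a ∧ g = monomial a (1 : K)}

/-- The initial ideal of `J`, as an ideal of `R_A`. -/
def initialOn (K : Type*) [Field K] (c : ℕ) (T : TermOrder (Fin c × ℕ)) (A : Set ℕ)
    (J : Set (PolyR K c)) : Set (PolyR K c) :=
  spanIn (RsetOn K c A) (leadMonSet K c T J)

/-- The chain of initial ideals `in_T(J_1) ⊆ in_T(J_2) ⊆ ...`. -/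
def inChain (K : Type*) [Field K] (c : ℕ) (T : TermOrder (Fin c × ℕ))
    (J : ℕ → Set (PolyR K c)) : ℕ → Set (PolyR K c) :=
  fun n => initialOn K c T {j | j < n} (J n)

/-- `I(J∘)`: the set of stability indices of initial ideal chains of `J` with respect to
`Inc(ℕ)`-compatible term orders. -/
def IndSet (K : Type*) [Field K] (c : ℕ) (J : ℕ → Set (PolyR K c)) : Set ℕ :=
  {N | ∃ T : TermOrder (Fin c × ℕ), IncCompatible c T ∧ Ind K c (inChain K c T J) = N}

/-- `S_n`: bijections of the variable indices fixing all indices outside the first `n`. -/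
def SymN (n : ℕ) : Set (ℕ → ℕ) := {σ | Function.Bijective σ ∧ ∀ i, n ≤ i → σ i = i}

/-- An `S_∞`-invariant ideal chain in `R`. -/
def IsSymChain (K : Type*) [Field K] (c : ℕ) (J : ℕ → Set (PolyR K c)) : Prop :=
  (∀ n, IsIdealOf (J n) (Rset K c n)) ∧
    ∀ m n, m ≤ n → ∀ σ ∈ SymN n, ∀ f ∈ J m, incAct K c σ f ∈ J n

/-- The exponent vectors of monomials of `R_n`. -/
def expIn (c n : ℕ) : Set (Fin c × ℕ →₀ ℕ) := {a | ∀ v ∈ a.support, v.2 < n}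

/-- The exponent vectors of the leading monomials of the nonzero elements of `J`. -/
def leadExp {K : Type*} [Field K] {c : ℕ} (T : TermOrder (Fin c × ℕ)) (J : Set (PolyR K c)) :
    Set (Fin c × ℕ →₀ ℕ) := {a | ∃ f ∈ J, IsLeadMon T f a}

theorem expIn_of_le {c n : ℕ} {a b : Fin c × ℕ →₀ ℕ} (hb : b ∈ expIn c n) (h : a ≤ b) :
    a ∈ expIn c n :=
  fun v hv => hb v (Finsupp.support_mono h hv)

theorem incVar_injective (c : ℕ) {p : ℕ → ℕ} (hp : StrictMono p) :
    Function.Injective (incVar c p) := by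
  rintro ⟨i, j⟩ ⟨i', j'⟩ h
  simp only [incVar, Prod.mk.injEq] at h
  exact Prod.ext h.1 (hp.injective h.2)

theorem le_of_mem_IncIn {m n : ℕ} {p : ℕ → ℕ} (hp : p ∈ IncIn m n) : m ≤ n := by
  by_contra! h
  exact absurd (hp.2 n h) (hp.1.le_apply).not_gt

theorem mem_Rset_iff {K : Type*} [Field K] {c n : ℕ} {f : PolyR K c} :
    f ∈ Rset K c n ↔ ∀ a ∈ f.support, a ∈ expIn c n := by
  simp only [Rset, RsetOn, SetLike.mem_coe, mem_supported, Set.subset_def,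
    mem_vars_iff_mem_support, expIn, Set.mem_ofPred_eq]
  exact ⟨fun h a ha v hv => h v ⟨a, ha, hv⟩, fun h v ⟨a, ha, hv⟩ => h a ha v hv⟩

theorem monomial_mem_Rset {K : Type*} [Field K] {c n : ℕ} {a : Fin c × ℕ →₀ ℕ}
    (ha : a ∈ expIn c n) (r : K) : monomial a r ∈ Rset K c n := by
  classical
  refine mem_Rset_iff.2 fun b hb => ?_
  rw [Finset.mem_singleton.1 (support_monomial_subset hb)]
  exact ha

theorem isIdealOf_Rset (K : Type*) [Field K] (c n : ℕ) :
    IsIdealOf (Rset K c n) (Rset K c n) :=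
  ⟨subset_rfl, Subalgebra.zero_mem _, fun _ hf _ hg => Subalgebra.add_mem _ hf hg,
    fun _ ha _ hf => Subalgebra.mul_mem _ ha hf⟩

theorem isIdealOf_spanIn {K : Type*} [Field K] {c n : ℕ} {S : Set (PolyR K c)}
    (hS : S ⊆ Rset K c n) :
    IsIdealOf (spanIn (Rset K c n) S) (Rset K c n) := by
  refine ⟨fun f hf => hf _ ⟨isIdealOf_Rset K c n, hS⟩, fun I hI => hI.1.2.1,
    fun f hf g hg I hI => hI.1.2.2.1 f (hf I hI) g (hg I hI),
    fun a ha f hf I hI => hI.1.2.2.2 a ha f (hf I hI)⟩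

namespace IsIdealOf

variable {K : Type*} [Field K] {c n : ℕ} {J : Set (PolyR K c)}

theorem smul_mem (hJ : IsIdealOf J (Rset K c n)) (r : K) {f : PolyR K c} (hf : f ∈ J) :
    r • f ∈ J := by
  rw [smul_eq_C_mul]
  exact hJ.2.2.2 _ (Subalgebra.algebraMap_mem _ r) _ hf

theorem sum_mem (hJ : IsIdealOf J (Rset K c n)) {ι : Type*} (s : Finset ι) (g : ι → PolyR K c)
    (hg : ∀ i ∈ s, g i ∈ J) : ∑ i ∈ s, g i ∈ J :=
  Finset.sum_induction g (· ∈ J) (fun a b ha hb => hJ.2.2.1 a ha b hb) hJ.2.1 hg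

theorem spanIn_subset (hJ : IsIdealOf J (Rset K c n)) {S : Set (PolyR K c)} (hS : S ⊆ J) :
    spanIn (Rset K c n) S ⊆ J := fun _ hf => hf _ ⟨hJ, hS⟩

end IsIdealOf

theorem subset_spanIn {K : Type*} [Field K] {c : ℕ} (A S : Set (PolyR K c)) : S ⊆ spanIn A S :=
  fun _ hf _ hI => hI.2 hf

theorem mapDomain_mem_expIn {c m n : ℕ} {p : ℕ → ℕ} (hp : p ∈ IncIn m n)
    {a : Fin c × ℕ →₀ ℕ} (ha : a ∈ expIn c m) : a.mapDomain (incVar c p) ∈ expIn c n := by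
  classical
  intro v hv
  obtain ⟨w, hw, rfl⟩ := Finset.mem_image.1 (Finsupp.mapDomain_support hv)
  exact hp.2 _ (ha w hw)

theorem incAct_mem_Rset {K : Type*} [Field K] {c m n : ℕ} {p : ℕ → ℕ} (hp : p ∈ IncIn m n)
    {f : PolyR K c} (hf : f ∈ Rset K c m) : incAct K c p f ∈ Rset K c n := by
  classical
  refine mem_Rset_iff.2 fun b hb => ?_
  rw [incAct, support_rename_of_injective (incVar_injective c hp.1)] at hb
  obtain ⟨a, ha, rfl⟩ := Finset.mem_image.1 hb
  exact mapDomain_mem_expIn hp (mem_Rset_iff.1 hf a ha)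

section LeadingExponents

variable {K : Type*} [Field K] {c : ℕ} {T : TermOrder (Fin c × ℕ)}

theorem TermOrder.le_of_le {σ : Type*} (T : TermOrder σ) {a b : σ →₀ ℕ} (h : a ≤ b) :
    T.le a b := by
  have := T.add_right _ _ a (T.zero_le (b - a))
  rwa [zero_add, tsub_add_cancel_of_le h] at this

theorem TermOrder.exists_max {σ : Type*} (T : TermOrder σ) {s : Finset (σ →₀ ℕ)}
    (hs : s.Nonempty) : ∃ a ∈ s, ∀ b ∈ s, T.le b a := by
  induction hs using Finset.Nonempty.cons_induction with
  | singleton a => exact ⟨a, by simp, by simpa using T.refl a⟩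
  | cons x s _ _ ih =>
    obtain ⟨a, ha, hmax⟩ := ih
    rcases T.total a x with h | h
    · refine ⟨x, by simp, fun b hb => ?_⟩
      rcases Finset.mem_cons.1 hb with rfl | hb
      · exact T.refl _
      · exact T.trans _ _ _ (hmax b hb) h
    · refine ⟨a, by simp [ha], fun b hb => ?_⟩
      rcases Finset.mem_cons.1 hb with rfl | hb
      · exact h
      · exact hmax b hb

theorem leadExp_subset {n : ℕ} {J : Set (PolyR K c)} (hJ : J ⊆ Rset K c n) :
    leadExp T J ⊆ expIn c n := by
  rintro a ⟨f, hf, ha, -⟩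
  exact mem_Rset_iff.1 (hJ hf) a ha

theorem add_mem_leadExp {n : ℕ} {J : Set (PolyR K c)} (hJ : IsIdealOf J (Rset K c n))
    {a h : Fin c × ℕ →₀ ℕ} (ha : a ∈ leadExp T J) (hh : h ∈ expIn c n) :
    a + h ∈ leadExp T J := by
  obtain ⟨f, hf, ha, hle⟩ := ha
  refine ⟨monomial h 1 * f, hJ.2.2.2 _ (monomial_mem_Rset hh 1) f hf, ?_, fun b hb => ?_⟩
  · rw [add_comm, mem_support_iff, coeff_monomial_mul, one_mul]
    exact mem_support_iff.1 ha
  · rw [mem_support_iff, coeff_monomial_mul'] at hb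
    split_ifs at hb with hhb
    · rw [one_mul] at hb
      have := T.add_right _ _ h (hle _ (mem_support_iff.2 hb))
      rwa [tsub_add_cancel_of_le hhb] at this
    · exact absurd rfl hb

theorem mem_leadExp_of_le {n : ℕ} {J : Set (PolyR K c)} (hJ : IsIdealOf J (Rset K c n))
    {a b : Fin c × ℕ →₀ ℕ} (ha : a ∈ leadExp T J) (hb : b ∈ expIn c n) (h : a ≤ b) :
    b ∈ leadExp T J := by
  rw [← add_tsub_cancel_of_le h]
  exact add_mem_leadExp hJ ha (expIn_of_le hb tsub_le_self)

theorem mapDomain_mem_leadExp (hT : IncCompatible c T) {J : ℕ → Set (PolyR K c)}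
    (hJ : IsIncChain K c J) {m n : ℕ} {p : ℕ → ℕ} (hp : p ∈ IncIn m n)
    {a : Fin c × ℕ →₀ ℕ} (ha : a ∈ leadExp T (J m)) :
    a.mapDomain (incVar c p) ∈ leadExp T (J n) := by
  classical
  obtain ⟨f, hf, ha, hle⟩ := ha
  refine ⟨incAct K c p f, hJ.2 m n (le_of_mem_IncIn hp) ⟨p, hp, f, hf, rfl⟩, ?_, ?_⟩
  · rw [incAct, support_rename_of_injective (incVar_injective c hp.1)]
    exact Finset.mem_image_of_mem _ ha
  · intro b hb
    rw [incAct, support_rename_of_injective (incVar_injective c hp.1)] at hb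
    obtain ⟨d, hd, rfl⟩ := Finset.mem_image.1 hb
    exact hT p hp.1 _ _ (hle d hd)

/-- Dickson's lemma for the monomials of `R_n`. -/
theorem expIn_partiallyWellOrderedOn (c n : ℕ) :
    (expIn c n).PartiallyWellOrderedOn (· ≤ ·) := by
  rw [Set.partiallyWellOrderedOn_iff_exists_lt]
  intro f hf
  obtain ⟨k, l, hkl, h⟩ := wellQuasiOrdered_le (α := Fin c × Fin n → ℕ)
    fun k v => f k (v.1, v.2)
  refine ⟨k, l, hkl, fun v => ?_⟩
  by_cases hv : v ∈ (f k).support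
  · exact h (v.1, ⟨v.2, hf k v hv⟩)
  · simp [Finsupp.notMem_support_iff.1 hv]

theorem TermOrder.wellFoundedOn (T : TermOrder (Fin c × ℕ)) (n : ℕ) :
    (expIn c n).WellFoundedOn fun a b => T.le a b ∧ ¬ T.le b a := by
  have : IsPreorder _ T.le := { refl := T.refl, trans := T.trans }
  refine Set.PartiallyWellOrderedOn.wellFoundedOn ?_
  rw [Set.partiallyWellOrderedOn_iff_exists_lt]
  intro f hf
  obtain ⟨k, l, hkl, h⟩ := (expIn_partiallyWellOrderedOn c n).exists_lt hf
  exact ⟨k, l, hkl, T.le_of_le h⟩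

/-- Existence of normal forms: modulo `J`, a monomial is congruent to a combination of
monomials that are not leading monomials of elements of `J`. -/
theorem exists_normalForm (T : TermOrder (Fin c × ℕ)) {n : ℕ} {J : Set (PolyR K c)}
    (hJ : IsIdealOf J (Rset K c n)) {a : Fin c × ℕ →₀ ℕ} (ha : a ∈ expIn c n) :
    ∃ g : PolyR K c, monomial a 1 - g ∈ J ∧ ∀ b ∈ g.support, b ∉ leadExp T J := by
  classical
  refine (T.wellFoundedOn n).induction ha (P := fun a => ∃ g : PolyR K c,
    monomial a 1 - g ∈ J ∧ ∀ b ∈ g.support, b ∉ leadExp T J) ?_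
  intro a ha ih
  by_cases hL : a ∈ leadExp T J
  swap
  · refine ⟨monomial a 1, by rw [sub_self]; exact hJ.2.1, fun b hb => ?_⟩
    rwa [Finset.mem_singleton.1 (support_monomial_subset hb)]
  obtain ⟨f, hf, hlead, hle⟩ := hL
  have hex : ∀ b : Fin c × ℕ →₀ ℕ, ∃ g : PolyR K c, b ∈ f.support.erase a →
      monomial b 1 - g ∈ J ∧ ∀ d ∈ g.support, d ∉ leadExp T J := by
    intro b
    by_cases hb : b ∈ f.support.erase a
    · obtain ⟨hne, hbf⟩ := Finset.mem_erase.1 hb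
      obtain ⟨g, hg⟩ := ih b (mem_Rset_iff.1 (hJ.1 hf) b hbf)
        ⟨hle b hbf, fun h => hne (T.antisymm _ _ (hle b hbf) h)⟩
      exact ⟨g, fun _ => hg⟩
    · exact ⟨0, fun h => absurd h hb⟩
  choose g hg using hex
  have hc0 : coeff a f ≠ 0 := mem_support_iff.1 hlead
  refine ⟨-(coeff a f)⁻¹ • ∑ b ∈ f.support.erase a, coeff b f • g b, ?_, fun d hd hdL => ?_⟩
  · have hmon : ∀ b, (monomial b (coeff b f) : PolyR K c) = coeff b f • monomial b 1 := by
      intro b; rw [smul_monomial, smul_eq_mul, mul_one]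
    have hsum : f = coeff a f • monomial a 1 +
        ∑ b ∈ f.support.erase a, coeff b f • (monomial b 1 : PolyR K c) := by
      conv_lhs => rw [f.as_sum, ← Finset.add_sum_erase _ _ hlead]
      simp only [hmon]
    have key : (monomial a 1 : PolyR K c) -
        -(coeff a f)⁻¹ • ∑ b ∈ f.support.erase a, coeff b f • g b =
        (coeff a f)⁻¹ • f + (-(coeff a f)⁻¹) • ∑ b ∈ f.support.erase a,
          coeff b f • (monomial b 1 - g b) := by
      have hnorm : (coeff a f)⁻¹ • f = (coeff a f)⁻¹ • (coeff a f • monomial a 1 +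
          ∑ b ∈ f.support.erase a, coeff b f • (monomial b 1 : PolyR K c)) :=
        congrArg ((coeff a f)⁻¹ • ·) hsum
      rw [smul_add, smul_smul, inv_mul_cancel₀ hc0] at hnorm
      rw [hnorm]
      simp only [smul_sub, Finset.sum_sub_distrib]
      module
    rw [key]
    exact hJ.2.2.1 _ (hJ.smul_mem _ hf) _ (hJ.smul_mem _ (hJ.sum_mem _ _ fun b hb =>
      hJ.smul_mem _ (hg b hb).1))
  · have hd1 := support_smul hd
    obtain ⟨b, hb, hdb⟩ := Finset.mem_biUnion.1 (support_sum hd1)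
    exact (hg b hb).2 d (support_smul hdb) hdL

/-- Two initial ideals of the same ideal cannot be strictly nested. -/
theorem leadExp_eq_of_subset {T' : TermOrder (Fin c × ℕ)} {n : ℕ} {J : Set (PolyR K c)}
    (hJ : IsIdealOf J (Rset K c n)) (h : leadExp T J ⊆ leadExp T' J) :
    leadExp T' J ⊆ leadExp T J := by
  classical
  intro b hb
  by_contra hbT
  obtain ⟨g, hgJ, hg⟩ := exists_normalForm T' hJ (leadExp_subset hJ.1 hb)
  have hoff : ∀ d ∈ (monomial b 1 - g).support, d ∉ leadExp T J := by
    intro d hd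
    rcases Finset.mem_union.1 (support_sub _ _ _ hd) with hd | hd
    · rwa [Finset.mem_singleton.1 (support_monomial_subset hd)]
    · exact fun hdT => hg d hd (h hdT)
  have hbs : b ∈ (monomial b 1 - g).support := by
    have : coeff b g = 0 := notMem_support_iff.1 fun hbg => hg b hbg hb
    rw [mem_support_iff, coeff_sub, this, coeff_monomial, if_pos rfl, sub_zero]
    exact one_ne_zero
  obtain ⟨d, hd, hmax⟩ := T.exists_max ⟨b, hbs⟩
  exact hoff d hd ⟨_, hgJ, hd, hmax⟩

end LeadingExponents

/-- Higman's lemma for monomials together with the width of the ring they live in. -/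
theorem exists_finset_incDivides (c : ℕ) (L : ℕ → Set (Fin c × ℕ →₀ ℕ))
    (hL : ∀ n, L n ⊆ expIn c n) :
    ∃ F : Finset (ℕ × (Fin c × ℕ →₀ ℕ)), (∀ x ∈ F, x.2 ∈ L x.1) ∧
      ∀ n, ∀ b ∈ L n, ∃ x ∈ F, ∃ p ∈ IncIn x.1 n, x.2.mapDomain (incVar c p) ≤ b := by
  classical
  by_contra! hF
  obtain ⟨f, hfL, hf⟩ := exists_seq_of_forall_finset_exists
    (fun x : ℕ × (Fin c × ℕ →₀ ℕ) => x.2 ∈ L x.1)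
    (fun x y => ∀ p ∈ IncIn x.1 y.1, ¬ x.2.mapDomain (incVar c p) ≤ y.2) (by
      intro s hs
      obtain ⟨n, b, hb, h⟩ := hF s hs
      exact ⟨(n, b), hb, h⟩)
  let w : ℕ → List (Fin c → ℕ) := fun k => List.ofFn fun j : Fin (f k).1 => fun i => (f k).2 (i, j)
  obtain ⟨k, l, hkl, h⟩ := ((Set.partiallyWellOrderedOn_univ_iff.2
    (wellQuasiOrdered_le (α := Fin c → ℕ))).partiallyWellOrderedOn_sublistForall₂ (· ≤ ·)).exists_lt
    (f := w) (by simp)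
  obtain ⟨u, hu, hul⟩ := List.sublistForall₂_iff.1 h
  obtain ⟨q, hq⟩ := List.sublist_iff_exists_orderEmbedding_getElem?_eq.1 hul
  have hlen : u.length = (f k).1 := by
    rw [← hu.length_eq]; simp [w]
  have hqlt : ∀ j < (f k).1, q j < (f l).1 := by
    intro j hj
    have h1 := hq j
    rw [List.getElem?_eq_getElem (by omega)] at h1
    have := (List.getElem?_eq_some_iff.1 h1.symm).1
    simpa [w] using this
  refine hf k l hkl q ⟨q.strictMono, hqlt⟩ fun v => ?_
  by_cases hv : v ∈ ((f k).2.mapDomain (incVar c q)).support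
  swap
  · simp [Finsupp.notMem_support_iff.1 hv]
  obtain ⟨⟨i, j⟩, hij, rfl⟩ := Finset.mem_image.1 (Finsupp.mapDomain_support hv)
  rw [Finsupp.mapDomain_apply (incVar_injective c q.strictMono)]
  have hj : j < (f k).1 := hL _ (hfL k) _ hij
  have h1 := hq j
  rw [List.getElem?_eq_getElem (by omega), List.getElem?_eq_getElem (by simpa [w] using hqlt j hj),
    Option.some_inj] at h1
  have h2 := (List.forall₂_iff_get.1 hu).2 j (by simpa [w] using hj) (by omega) i
  simp only [List.get_eq_getElem] at h2
  rw [h1] at h2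
  simpa [w, incVar] using h2

/-- Every element of `Inc(ℕ)_{m,n}` factors, on the first `m` indices, through
`Inc(ℕ)_{m,N}` and `Inc(ℕ)_{N,n}`. -/
theorem exists_factor_IncIn {m N n : ℕ} (hmN : m ≤ N) (hNn : N ≤ n) {p : ℕ → ℕ}
    (hp : p ∈ IncIn m n) :
    ∃ r ∈ IncIn m N, ∃ q ∈ IncIn N n, ∀ j < m, q (r j) = p j := by
  classical
  obtain ⟨t, hst, htn, htN⟩ := Finset.exists_subsuperset_card_eq (n := N)
    (s := (Finset.range m).image p) (t := Finset.range n)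
    (by
      intro x hx
      obtain ⟨j, hj, rfl⟩ := Finset.mem_image.1 hx
      exact Finset.mem_range.2 (hp.2 j (Finset.mem_range.1 hj)))
    (by rwa [Finset.card_image_of_injective _ hp.1.injective, Finset.card_range])
    (by rwa [Finset.card_range])
  let P : ℕ → Prop := fun x => x ∈ t ∨ n ≤ x
  let e : ℕ → ℕ := fun j => if j < m then p j else n + j
  have he : StrictMono e := by
    intro i j hij
    simp only [e]
    split_ifs with h1 h2
    · exact hp.1 hij
    · have := hp.2 i h1; omega
    · omega
    · omega
  have heP : ∀ j, P (e j) := by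
    intro j
    simp only [e, P]
    split_ifs with h
    · exact Or.inl (hst (Finset.mem_image_of_mem _ (Finset.mem_range.2 h)))
    · exact Or.inr (by omega)
  have hinf : (Set.ofPred P).Infinite :=
    (Set.Ici_infinite n).mono fun x hx => Or.inr hx
  have hcount : Nat.count P n = N := by
    rw [Nat.count_eq_card_filter_range, ← htN]
    congr 1
    ext x
    simp only [Finset.mem_filter, Finset.mem_range, P]
    exact ⟨fun h => h.2.resolve_right (by omega), fun h => ⟨Finset.mem_range.1 (htn h), Or.inl h⟩⟩
  refine ⟨fun j => Nat.count P (e j), ⟨fun i j hij => Nat.count_strict_mono (heP i) (he hij),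
    fun j hj => ?_⟩, Nat.nth P, ⟨Nat.nth_strictMono hinf, fun j hj => ?_⟩, fun j hj => ?_⟩
  · rw [← hcount]
    refine Nat.count_strict_mono (heP j) ?_
    simpa [e, hj] using hp.2 j hj
  · exact Nat.nth_lt_of_lt_count (by rwa [hcount])
  · rw [Nat.nth_count (heP j)]
    simp [e, hj]

/-- If the leading exponents at all `n ≥ N` come from those at `N`, then the chain of initial
ideals is stable from `N` on. -/
theorem mem_stabSet_inChain {K : Type*} [Field K] {c : ℕ} {T : TermOrder (Fin c × ℕ)}
    (hT : IncCompatible c T) {J : ℕ → Set (PolyR K c)} (hJ : IsIncChain K c J) {N : ℕ}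
    (h : ∀ n, N ≤ n → ∀ b ∈ leadExp T (J n), ∃ p ∈ IncIn N n, ∃ a ∈ leadExp T (J N),
      a.mapDomain (incVar c p) ≤ b) :
    N ∈ stabSet K c (inChain K c T J) := by
  have hlead : ∀ n, leadMonSet K c T (J n) ⊆ Rset K c n := by
    rintro n _ ⟨f, hf, -, a, ha, rfl⟩
    exact monomial_mem_Rset (leadExp_subset (hJ.1 n).1 ⟨f, hf, ha⟩) 1
  have hin : ∀ n, IsIdealOf (inChain K c T J n) (Rset K c n) := fun n =>
    isIdealOf_spanIn (hlead n)
  have hmon : ∀ n, ∀ a ∈ leadExp T (J n), monomial a (1 : K) ∈ inChain K c T J n := by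
    rintro n a ⟨f, hf, ha⟩
    refine subset_spanIn _ _ ⟨f, hf, ?_, a, ha, rfl⟩
    rintro rfl
    simpa using ha.1
  intro n hNn
  have horb : incOrbit K c N n (inChain K c T J N) ⊆ inChain K c T J n := by
    rintro _ ⟨p, hp, f, hf, rfl⟩
    have hI : IsIdealOf {g | g ∈ Rset K c N ∧ incAct K c p g ∈ inChain K c T J n}
        (Rset K c N) := by
      refine ⟨fun g hg => hg.1, ⟨(isIdealOf_Rset K c N).2.1, ?_⟩, ?_, ?_⟩
      · rw [map_zero]; exact (hin n).2.1
      · rintro g ⟨hg, hg'⟩ g₂ ⟨hg₂, hg₂'⟩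
        refine ⟨(isIdealOf_Rset K c N).2.2.1 _ hg _ hg₂, ?_⟩
        rw [map_add]; exact (hin n).2.2.1 _ hg' _ hg₂'
      · rintro a ha g ⟨hg, hg'⟩
        refine ⟨(isIdealOf_Rset K c N).2.2.2 _ ha _ hg, ?_⟩
        rw [map_mul]; exact (hin n).2.2.2 _ (incAct_mem_Rset hp ha) _ hg'
    refine (hI.spanIn_subset ?_ hf).2
    intro g hg
    refine ⟨hlead N hg, ?_⟩
    obtain ⟨f, hf, -, a, ha, rfl⟩ := hg
    rw [incAct, rename_monomial]
    exact hmon n _ (mapDomain_mem_leadExp hT hJ hp ⟨f, hf, ha⟩)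
  refine subset_antisymm ((hin n).spanIn_subset horb) ?_
  have hsp := isIdealOf_spanIn (horb.trans (hin n).1)
  refine hsp.spanIn_subset ?_
  rintro _ ⟨f, hf, -, b, hb, rfl⟩
  obtain ⟨p, hp, a, ha, hab⟩ := h n hNn b ⟨f, hf, hb⟩
  have hbn := leadExp_subset (hJ.1 n).1 ⟨f, hf, hb⟩
  have : (monomial b (1 : K)) = monomial (b - a.mapDomain (incVar c p)) 1 *
      incAct K c p (monomial a 1) := by
    rw [incAct, rename_monomial, monomial_mul, tsub_add_cancel_of_le hab, one_mul]
  rw [this]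
  exact hsp.2.2.2 _ (monomial_mem_Rset (expIn_of_le hbn tsub_le_self) 1) _
    (subset_spanIn _ _ ⟨p, hp, _, hmon N a ha, rfl⟩)

/-- For a compatible term order `T`, there are finitely many leading exponents and a bound `N`
such that every compatible term order sharing these leading exponents has initial chain
stable from `N` on. -/
theorem exists_finset_stable {K : Type*} [Field K] {c : ℕ} (T : TermOrder (Fin c × ℕ))
    {J : ℕ → Set (PolyR K c)} (hJ : IsIncChain K c J) :
    ∃ (F : Finset (ℕ × (Fin c × ℕ →₀ ℕ))) (N : ℕ), (∀ x ∈ F, x.2 ∈ leadExp T (J x.1)) ∧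
      ∀ T' : TermOrder (Fin c × ℕ), IncCompatible c T' →
        (∀ x ∈ F, x.2 ∈ leadExp T' (J x.1)) → N ∈ stabSet K c (inChain K c T' J) := by
  obtain ⟨F, hF, hFdiv⟩ := exists_finset_incDivides c (fun n => leadExp T (J n))
    fun n => leadExp_subset (hJ.1 n).1
  refine ⟨F, F.sup Prod.fst, hF, fun T' hT' hF' => mem_stabSet_inChain hT' hJ ?_⟩
  intro n hn b hb
  have hsub : leadExp T (J n) ⊆ leadExp T' (J n) := by
    intro d hd
    obtain ⟨x, hx, p, hp, hle⟩ := hFdiv n d hd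
    exact mem_leadExp_of_le (hJ.1 n) (mapDomain_mem_leadExp hT' hJ hp (hF' x hx))
      (leadExp_subset (hJ.1 n).1 hd) hle
  obtain ⟨x, hx, p, hp, hle⟩ := hFdiv n b (leadExp_eq_of_subset (hJ.1 n) hsub hb)
  obtain ⟨r, hr, q, hq, hqr⟩ := exists_factor_IncIn (Finset.le_sup (f := Prod.fst) hx) hn hp
  refine ⟨q, hq, _, mapDomain_mem_leadExp hT' hJ hr (hF' x hx), ?_⟩
  rw [← Finsupp.mapDomain_comp]
  convert hle using 1
  refine Finsupp.mapDomain_congr fun v hv => ?_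
  exact Prod.ext rfl (hqr _ (leadExp_subset (hJ.1 x.1).1 (hF x hx) v hv))

/-- The limit of a family of term orders along an ultrafilter. -/
def TermOrder.ultralimit {σ ι : Type*} (U : Ultrafilter ι) (T : ι → TermOrder σ) :
    TermOrder σ where
  le a b := ∀ᶠ k in U, (T k).le a b
  refl a := .of_forall fun k => (T k).refl a
  trans a b d hab hbd := by
    filter_upwards [hab, hbd] with k h1 h2 using (T k).trans _ _ _ h1 h2
  antisymm a b hab hba := by
    obtain ⟨k, h1, h2⟩ := (hab.and hba).exists
    exact (T k).antisymm _ _ h1 h2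
  total a b := Ultrafilter.eventually_or.1 (.of_forall fun k => (T k).total a b)
  add_right a b h hab := hab.mono fun k hk => (T k).add_right _ _ h hk
  zero_le a := .of_forall fun k => (T k).zero_le a

/-- **Theorem (Statement 0).** For every `Inc(ℕ)`-invariant ideal chain `J∘` in `R`,
the set `I(J∘)` of stability indices of initial ideal chains of `J∘` with respect to
`Inc(ℕ)`-compatible term orders is bounded above (and hence finite). -/
theorem indSet_bddAbove (K : Type*) [Field K] (c : ℕ) (hc : 0 < c)
    (J : ℕ → Set (PolyR K c)) (hJ : IsIncChain K c J) :
    BddAbove (IndSet K c J) := by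
  by_contra hunb
  rw [not_bddAbove_iff] at hunb
  have hT : ∀ k, ∃ T : TermOrder (Fin c × ℕ), IncCompatible c T ∧
      k < Ind K c (inChain K c T J) := by
    intro k
    obtain ⟨_, ⟨T, hT, rfl⟩, hk⟩ := hunb k
    exact ⟨T, hT, hk⟩
  choose T hT hTk using hT
  obtain ⟨F, N, hF, hstab⟩ :=
    exists_finset_stable (TermOrder.ultralimit (Filter.hyperfilter ℕ) T) hJ
  have hev : ∀ᶠ k in Filter.hyperfilter ℕ, ∀ x ∈ F, x.2 ∈ leadExp (T k) (J x.1) := by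
    rw [Filter.eventually_all_finset]
    intro x hx
    obtain ⟨f, hf, hxf, hle⟩ := hF x hx
    have : ∀ᶠ k in Filter.hyperfilter ℕ, ∀ b ∈ f.support, (T k).le b x.2 := by
      rw [Filter.eventually_all_finset]
      exact hle
    exact this.mono fun k hk => ⟨f, hf, hxf, hk⟩
  have hlarge : ∀ᶠ k in Filter.hyperfilter ℕ, N ≤ k :=
    Nat.hyperfilter_le_atTop (Filter.eventually_ge_atTop N)
  obtain ⟨k, hk, hNk⟩ := (hev.and hlarge).exists
  exact absurd (Nat.sInf_le (hstab (T k) (hT k) hk)) (not_le.2 (hNk.trans_lt (hTk k)))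
end

section
/- For natural numbers l ≤ m ≤ n, Inc(ℕ)_{l,n} = Inc(ℕ)_{m,n} ∘ Inc(ℕ)_{l,m}: for every p₁ ∈ Inc(ℕ)_{l,m} and p₂ ∈ Inc(ℕ)_{m,n} one has p₂ ∘ p₁ ∈ Inc(ℕ)_{l,n}, and conversely every p ∈ Inc(ℕ)_{l,n} admits such a decomposition p = p₂ ∘ p₁. -/
/-- **Lemma (Statement 1).** For natural numbers `l ≤ m ≤ n`,
`Inc(ℕ)_{l,n} = Inc(ℕ)_{m,n} ∘ Inc(ℕ)_{l,m}`: for every `p₁ ∈ Inc(ℕ)_{l,m}` and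
`p₂ ∈ Inc(ℕ)_{m,n}` one has `p₂ ∘ p₁ ∈ Inc(ℕ)_{l,n}`, and conversely every
`p ∈ Inc(ℕ)_{l,n}` admits such a decomposition `p = p₂ ∘ p₁`. -/
theorem incIn_decomposition (l m n : ℕ) (hlm : l ≤ m) (hmn : m ≤ n) :
    IncIn l n = {p : ℕ → ℕ | ∃ p₁ ∈ IncIn l m, ∃ p₂ ∈ IncIn m n, p = p₂ ∘ p₁} := by
  classical
  ext p
  constructor
  · rintro ⟨hp, hpl⟩
    by_cases h : ∀ j < m, p j < n
    · exact ⟨id, ⟨strictMono_id, fun j hj => hj.trans_le hlm⟩, p, ⟨hp, h⟩, rfl⟩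
    push Not at h
    obtain ⟨i, him, hi⟩ := h
    have hcard : ((Finset.range n).filter (· ∈ Set.range p)).card ≤ m := by
      have hsub : (Finset.range n).filter (· ∈ Set.range p) ⊆ (Finset.range i).image p := by
        intro x hx
        obtain ⟨hxn, j, rfl⟩ := Finset.mem_filter.1 hx
        have hj : p j < p i := (Finset.mem_range.1 hxn).trans_le hi
        exact Finset.mem_image_of_mem p (Finset.mem_range.2 (hp.lt_iff_lt.1 hj))
      have h₁ := Finset.card_le_card hsub
      have h₂ := (Finset.card_image_le (s := Finset.range i) (f := p))
      rw [Finset.card_range] at h₂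
      omega
    obtain ⟨T, hAT, hTn, hTm⟩ := Finset.exists_subsuperset_card_eq
      (Finset.filter_subset (· ∈ Set.range p) (Finset.range n)) hcard (by simpa using hmn)
    -- `B` contains the range of `p` and has exactly `m` elements below `n`.
    let B : ℕ → Prop := fun x => x ∈ T ∨ (n ≤ x ∧ x ∈ Set.range p)
    have hB : ∀ j, B (p j) := fun j => by
      rcases lt_or_ge (p j) n with hj | hj
      · exact Or.inl (hAT (Finset.mem_filter.2 ⟨Finset.mem_range.2 hj, j, rfl⟩))
      · exact Or.inr ⟨hj, j, rfl⟩
    have hinf : {x | B x}.Infinite :=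
      (Set.infinite_range_of_injective hp.injective).mono (by rintro _ ⟨j, rfl⟩; exact hB j)
    have hcount : Nat.count B n = m := by
      rw [Nat.count_eq_card_filter_range, ← hTm]
      congr 1
      ext x
      simp only [Finset.mem_filter, Finset.mem_range]
      constructor
      · rintro ⟨hx, hxT | ⟨hnx, -⟩⟩
        · exact hxT
        · omega
      · exact fun hx => ⟨Finset.mem_range.1 (hTn hx), Or.inl hx⟩
    refine ⟨fun j => Nat.count B (p j), ⟨fun a b hab => Nat.count_strict_mono (hB a) (hp hab),
      fun j hj => ?_⟩, Nat.nth B, ⟨Nat.nth_strictMono hinf, fun j hj => ?_⟩, ?_⟩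
    · exact (Nat.count_strict_mono (hB j) (hpl j hj)).trans_eq hcount
    · exact Nat.nth_lt_of_lt_count (hcount.symm ▸ hj)
    · funext j
      exact (Nat.nth_count (hB j)).symm
  · rintro ⟨p₁, ⟨h₁, h₁'⟩, p₂, ⟨h₂, h₂'⟩, rfl⟩
    exact ⟨h₂.comp h₁, fun j hj => h₂' _ (h₁' j hj)⟩
end

section
/- Let N, l ∈ ℕ, n ≥ N, and let i₁ < ... < i_l ≤ N and j₁ < ... < j_l ≤ n be two strictly ascending sequences of natural numbers. Then there exists p ∈ Inc(ℕ)_{N,n} with p(i_r) = j_r for all r ∈ [l] if and only if j_r − j_{r−1} ≥ i_r − i_{r−1} for all r ∈ [l+1], where i₀ = j₀ = 0 and i_{l+1} = N+1, j_{l+1} = n+1. -/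
/-- A sequence that increases at each step below `m` is monotone on `{0, ..., m}`. -/
theorem le_of_forall_lt_le_succ {m : ℕ} {f : ℕ → ℕ} (hf : ∀ r < m, f r ≤ f (r + 1))
    {s t : ℕ} (hst : s ≤ t) (ht : t ≤ m) : f s ≤ f t := by
  induction t, hst using Nat.le_induction with
  | base => exact le_rfl
  | succ t _ ih => exact (ih (by lia)).trans (hf t (by lia))

/-- A strictly monotone function on the natural numbers does not shrink distances. -/
theorem StrictMono.add_sub_le_nat {p : ℕ → ℕ} (hp : StrictMono p) {a b : ℕ} (hab : a ≤ b) :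
    p a + (b - a) ≤ p b := by
  induction b, hab using Nat.le_induction with
  | base => simp
  | succ b _ ih =>
    have := hp (Nat.lt_succ_self b)
    lia

/-- The self-map of `ℕ` shifting `x` by the largest `d r` with `r ≤ l` and `i r ≤ x`. -/
def shiftBySup (l : ℕ) (i d : ℕ → ℕ) (x : ℕ) : ℕ :=
  x + ((Finset.range (l + 1)).filter (fun r => i r ≤ x)).sup d

theorem shiftBySup_strictMono (l : ℕ) (i d : ℕ → ℕ) : StrictMono (shiftBySup l i d) := by
  intro x y hxy
  refine add_lt_add_of_lt_of_le hxy (Finset.sup_mono ?_)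
  exact Finset.monotone_filter_right _ fun r _ hr => hr.trans hxy.le

theorem shiftBySup_le {l : ℕ} {i d : ℕ → ℕ} {x c : ℕ}
    (h : ∀ r ≤ l, i r ≤ x → d r ≤ c) : shiftBySup l i d x ≤ x + c := by
  refine Nat.add_le_add_left (Finset.sup_le fun r hr => ?_) x
  rw [Finset.mem_filter, Finset.mem_range] at hr
  exact h r (by lia) hr.2

theorem le_shiftBySup {l : ℕ} {i d : ℕ → ℕ} {x r : ℕ} (hr : r ≤ l) (hx : i r ≤ x) :
    x + d r ≤ shiftBySup l i d x := by
  refine Nat.add_le_add_left (Finset.le_sup (f := d) ?_) x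
  rw [Finset.mem_filter, Finset.mem_range]
  exact ⟨by lia, hx⟩

/-- **Lemma (Statement 2).** Let `N, l ∈ ℕ`, `n ≥ N`, and let `i₁ < ... < i_l ≤ N` and
`j₁ < ... < j_l ≤ n` be two strictly ascending sequences of (positive) natural numbers.
Then there exists `p ∈ Inc(ℕ)_{N,n}` with `p(i_r) = j_r` for all `r ∈ [l]` if and only if
`j_r − j_{r−1} ≥ i_r − i_{r−1}` for all `r ∈ [l+1]`, where `i₀ = j₀ = 0` and
`i_{l+1} = N+1`, `j_{l+1} = n+1`.

Here a strictly increasing self-map of the positive natural numbers is encoded as a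
strictly monotone `p : ℕ → ℕ` (its value at `0` being irrelevant), and the condition
`p ∈ Inc(ℕ)_{N,n}` as `p N ≤ n`.  The data `i₁ < ... < i_l ≤ N` is encoded by the
extended sequence `i 0 = 0 < i 1 < ... < i l < i (l+1) = N + 1`, and similarly for `j`. -/
theorem exists_incIn_mapping_sequences_iff (N l n : ℕ) (hN : 1 ≤ N) (hl : 1 ≤ l)
    (hn : N ≤ n) (i j : ℕ → ℕ)
    (hi0 : i 0 = 0) (hj0 : j 0 = 0)
    (hitop : i (l + 1) = N + 1) (hjtop : j (l + 1) = n + 1)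
    (hiasc : ∀ r ≤ l, i r < i (r + 1)) (hjasc : ∀ r ≤ l, j r < j (r + 1)) :
    (∃ p : ℕ → ℕ, StrictMono p ∧ p N ≤ n ∧ ∀ r, 1 ≤ r → r ≤ l → p (i r) = j r) ↔
      ∀ r, 1 ≤ r → r ≤ l + 1 → i r - i (r - 1) ≤ j r - j (r - 1) := by
  constructor
  · rintro ⟨p, hp, hpN, hpi⟩ r hr1 hrl
    obtain ⟨s, rfl⟩ : ∃ s, r = s + 1 := ⟨r - 1, by lia⟩
    rw [Nat.add_sub_cancel]
    have hlt := hiasc s (by lia)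
    have hjs : j s ≤ p (i s) := by
      rcases Nat.eq_zero_or_pos s with rfl | hs
      · simp [hj0]
      · exact (hpi s hs (by lia)).ge
    rcases Nat.lt_or_ge s l with hs | hs
    · have hps := hpi (s + 1) hr1 hs
      rcases Nat.eq_zero_or_pos s with rfl | hs0
      · have := hp.le_apply (x := i (0 + 1))
        lia
      · have := hp.add_sub_le_nat hlt.le
        have := hpi s hs0 hs.le
        lia
    · obtain rfl : s = l := by lia
      have := hp.add_sub_le_nat (a := i s) (b := N) (by lia)
      lia
  · intro h
    have hstep : ∀ r ≤ l, i (r + 1) - i r ≤ j (r + 1) - j r := fun r hr =>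
      h (r + 1) (by lia) (by lia)
    have hij : ∀ r ≤ l + 1, i r ≤ j r := by
      intro r
      induction r with
      | zero => simp [hi0]
      | succ r ih =>
        intro hr
        have := ih (by lia)
        have := hstep r (by lia)
        have := hiasc r (by lia)
        lia
    have hd : ∀ r < l + 1, j r - i r ≤ j (r + 1) - i (r + 1) := by
      intro r hr
      have := hstep r (by lia)
      have := hiasc r (by lia)
      have := hjasc r (by lia)
      lia
    have hdmono : ∀ {s t}, s ≤ t → t ≤ l + 1 → j s - i s ≤ j t - i t := fun hst ht =>
      le_of_forall_lt_le_succ (f := fun r => j r - i r) hd hst ht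
    refine ⟨shiftBySup l i fun r => j r - i r, shiftBySup_strictMono _ _ _, ?_, ?_⟩
    · have := shiftBySup_le (l := l) (i := i) (d := fun r => j r - i r) (x := N)
        (c := j (l + 1) - i (l + 1)) fun r hr _ => hdmono (by lia) le_rfl
      lia
    · intro r _ hrl
      have hle := shiftBySup_le (l := l) (i := i) (d := fun r => j r - i r) (x := i r)
        (c := j r - i r) fun s hs hsr => hdmono (by
          by_contra! hlt
          have := hiasc r hrl
          have := le_of_forall_lt_le_succ (m := l + 1) (f := i)
            (fun k hk => (hiasc k (by lia)).le) (Nat.succ_le_of_lt hlt) (by lia)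
          lia) (by lia)
      have hge := le_shiftBySup (d := fun r => j r - i r) hrl (le_refl (i r))
      have := hij r (by lia)
      lia
end

section
/- Let J ⊆ R_n be an ideal satisfying S_n·J ⊆ J, let m ≤ n and p ∈ Inc(ℕ)_{m,n}. Then p·(J ∩ R_m) = J ∩ R_{p([m])}. In particular, for every f ∈ J ∩ R_m the polynomial p·f lies in J. -/
open MvPolynomial

/-- A map injective on `{j < m}` with values below `n` extends to a permutation of `ℕ`
fixing all indices from `n` on. -/
theorem exists_perm_extending {m n : ℕ} (hmn : m ≤ n) {p : ℕ → ℕ}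
    (hinj : Set.InjOn p {j | j < m}) (hlt : ∀ j < m, p j < n) :
    ∃ σ : Equiv.Perm ℕ, (∀ i, n ≤ i → σ i = i) ∧ ∀ j < m, σ j = p j := by
  obtain ⟨g, hg⟩ := Set.MapsTo.exists_equiv_extend_of_card_eq (α := Fin n)
    (t := Finset.range n) (by simp) (s := {i | (i : ℕ) < m}) (f := fun i => p i)
    (fun i hi => by simpa using hlt i hi)
    (fun i hi j hj h => Fin.ext (hinj hi hj h))
  let e : Equiv.Perm (Fin n) := g.trans
    ⟨fun x => ⟨x, Finset.mem_range.1 x.2⟩, fun x => ⟨x, Finset.mem_range.2 x.2⟩,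
      fun _ => rfl, fun _ => rfl⟩
  refine ⟨e.extendDomain (p := (· < n)) Fin.equivSubtype, fun i hi => ?_, fun j hj => ?_⟩
  · exact e.extendDomain_apply_not_subtype _ (by simpa using hi)
  · have hjn : j < n := hj.trans_le hmn
    have h := e.extendDomain_apply_subtype (p := (· < n)) Fin.equivSubtype hjn
    exact h.trans (hg ⟨j, hjn⟩ hj)

theorem incAct_congr {K : Type*} [Field K] {c : ℕ} {A : Set ℕ} {p q : ℕ → ℕ}
    (h : Set.EqOn p q A) {f : PolyR K c} (hf : f ∈ RsetOn K c A) :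
    incAct K c p f = incAct K c q f := by
  rw [RsetOn, SetLike.mem_coe, supported_eq_range_rename] at hf
  obtain ⟨g, rfl⟩ := hf
  simp only [incAct, RingHom.coe_coe, AlgHom.toRingHom_eq_coe, rename_rename]
  congr 2
  funext v
  exact Prod.ext rfl (h v.2)

theorem incAct_mem_RsetOn {K : Type*} [Field K] {c : ℕ} {A B : Set ℕ} {p : ℕ → ℕ}
    (h : Set.MapsTo p A B) {f : PolyR K c} (hf : f ∈ RsetOn K c A) :
    incAct K c p f ∈ RsetOn K c B := by
  classical
  rw [RsetOn, SetLike.mem_coe, mem_supported] at hf ⊢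
  intro v hv
  obtain ⟨w, hw, rfl⟩ := Finset.mem_image.1 (vars_rename (incVar c p) f hv)
  exact h (hf hw)

theorem incAct_incAct_of_leftInverse {K : Type*} [Field K] {c : ℕ} {p q : ℕ → ℕ}
    (h : Function.LeftInverse p q) (f : PolyR K c) : incAct K c p (incAct K c q f) = f := by
  have hid : incVar c p ∘ incVar c q = id := funext fun v => Prod.ext rfl (h v.2)
  rw [incAct, incAct, rename_rename, hid, rename_id_apply]

/-- **Lemma (Statement 8).** Let `J ⊆ R_n` be an ideal satisfying `S_n·J ⊆ J`, let `m ≤ n`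
and `p ∈ Inc(ℕ)_{m,n}`. Then `p·(J ∩ R_m) = J ∩ R_{p([m])}`. In particular, for every
`f ∈ J ∩ R_m` the polynomial `p·f` lies in `J`. -/
theorem incAct_image_inter_eq (K : Type*) [Field K] (c : ℕ) (hc : 0 < c)
    (m n : ℕ) (hmn : m ≤ n)
    (J : Set (PolyR K c)) (hJ : IsIdealOf J (Rset K c n))
    (hsym : ∀ σ ∈ SymN n, ∀ f ∈ J, incAct K c σ f ∈ J)
    (p : ℕ → ℕ) (hp : p ∈ IncIn m n) :
    (incAct K c p) '' (J ∩ Rset K c m) = J ∩ RsetOn K c (p '' {j | j < m}) ∧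
      ∀ f ∈ J ∩ Rset K c m, incAct K c p f ∈ J := by
  obtain ⟨σ, hfix, hσ⟩ := exists_perm_extending hmn hp.1.injective.injOn hp.2
  have heq : ∀ f ∈ Rset K c m, incAct K c p f = incAct K c σ f := fun f hf =>
    incAct_congr (fun j hj => (hσ j hj).symm) hf
  have hmem : ∀ f ∈ J ∩ Rset K c m, incAct K c p f ∈ J := fun f hf => by
    rw [heq f hf.2]
    exact hsym σ ⟨σ.bijective, hfix⟩ f hf.1
  refine ⟨Set.Subset.antisymm ?_ ?_, hmem⟩
  · rintro _ ⟨f, hf, rfl⟩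
    exact ⟨hmem f hf, incAct_mem_RsetOn (Set.mapsTo_image _ _) hf.2⟩
  · rintro g ⟨hgJ, hg⟩
    have hmaps : Set.MapsTo σ.symm (p '' {j | j < m}) {j | j < m} := by
      rintro _ ⟨j, hj, rfl⟩
      rwa [← hσ j hj, σ.symm_apply_apply]
    have hgm : incAct K c σ.symm g ∈ Rset K c m := incAct_mem_RsetOn hmaps hg
    have hgJ' : incAct K c σ.symm g ∈ J :=
      hsym _ ⟨σ.symm.bijective, fun i hi => σ.symm_apply_eq.2 (hfix i hi).symm⟩ g hgJ
    refine ⟨_, ⟨hgJ', hgm⟩, ?_⟩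
    rw [heq _ hgm, incAct_incAct_of_leftInverse σ.apply_symm_apply]
end
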